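/- Let n ≥ 1 and let λ = (λ_1 ≥ λ_2 ≥ … ≥ λ_n ≥ 0) be a partition with at most n nonzero parts, padded with zeros to length n. In any commutative ring, for every unit β: Σ_{T ∈ SVT(λ, n)} (−β^{−1})^{|T| − |λ|} · β^{|T|} = β^{|λ|}. Equivalently, writing G_λ(x_1,…,x_n | β) = Σ_{T ∈ SVT(λ,n)} β^{|T|−|λ|} x_1^{ω_1(T)} ⋯ x_n^{ω_n(T)} for the tableau-sum Grothendieck polynomial, one has G_λ(β, β, …, β | −β^{−1}) = β^{|λ|}. -/

import Mathlib

open Finset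

/-- The set of boxes of the Young diagram of `lam` within the first `n` rows
(rows indexed `0, …, n-1`; box `(i,j)` is present iff `j < lam i`). -/
def youngCells (n : ℕ) (lam : ℕ → ℕ) : Finset (ℕ × ℕ) :=
  (Finset.range n).biUnion fun i => {i} ×ˢ Finset.range (lam i)

/-- Set-valued tableaux of shape `lam` with entries in `{1, …, n}`, encoded as finite
sets of pairs (box, entry): the nonempty set assigned to a box `p` is `{e | (p, e) ∈ T}`.
The conditions say: every box of the diagram gets at least one entry; all entries lie in
`{1, …, n}`; entries weakly increase along rows (`max T_{i,j} ≤ min T_{i,j+1}`) and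
strictly increase down columns (`max T_{i,j} < min T_{i+1,j}`).
For a tableau `T`, the total number of assigned entries `|T|` is `T.card`. -/
def SVT (n : ℕ) (lam : ℕ → ℕ) : Finset (Finset ((ℕ × ℕ) × ℕ)) :=
  ((youngCells n lam) ×ˢ Finset.Icc 1 n).powerset.filter fun T =>
    (∀ p ∈ youngCells n lam, ∃ x ∈ T, x.1 = p) ∧
    (∀ x ∈ T, ∀ y ∈ T, x.1.1 = y.1.1 → x.1.2 + 1 = y.1.2 → x.2 ≤ y.2) ∧
    (∀ x ∈ T, ∀ y ∈ T, x.1.1 + 1 = y.1.1 → x.1.2 = y.1.2 → x.2 < y.2)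

/-- A box containing an entry other than the minimal possible one. -/
def badBox (T : Finset ((ℕ × ℕ) × ℕ)) (k : ℕ) : Prop :=
  ∃ e, (Nat.unpair k, e) ∈ T ∧ e ≠ (Nat.unpair k).1 + 1

open Classical in
/-- The entry to toggle, in terms of the predicate of bad boxes. -/
noncomputable def togOf (P : ℕ → Prop) : (ℕ × ℕ) × ℕ :=
  if h : ∃ k, P k then
    (Nat.unpair (Nat.find h), (Nat.unpair (Nat.find h)).1 + 1)
  else ((0, 0), 0)

/-- The entry to toggle: the minimal entry in the first bad box. -/
noncomputable def togEntry (T : Finset ((ℕ × ℕ) × ℕ)) : (ℕ × ℕ) × ℕ := togOf (badBox T)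

/-- Toggle membership of an element. -/
def tog (T : Finset ((ℕ × ℕ) × ℕ)) (x : (ℕ × ℕ) × ℕ) : Finset ((ℕ × ℕ) × ℕ) :=
  if x ∈ T then T.erase x else insert x T

lemma mem_youngCells {n : ℕ} {lam : ℕ → ℕ} {p : ℕ × ℕ} :
    p ∈ youngCells n lam ↔ p.1 < n ∧ p.2 < lam p.1 := by
  rcases p with ⟨i, j⟩
  simp only [youngCells, Finset.mem_biUnion, Finset.mem_range, Finset.mem_product,
    Finset.mem_singleton]
  constructor
  · rintro ⟨a, ha, rfl, hj⟩
    exact ⟨ha, hj⟩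
  · rintro ⟨h1, h2⟩
    exact ⟨i, h1, rfl, h2⟩

lemma card_youngCells (n : ℕ) (lam : ℕ → ℕ) :
    (youngCells n lam).card = ∑ i ∈ Finset.range n, lam i := by
  unfold youngCells
  rw [Finset.card_biUnion]
  · simp
  · intro a _ b _ hab
    rw [Function.onFun, Finset.disjoint_left]
    rintro ⟨i, j⟩ h1 h2
    simp only [Finset.mem_product, Finset.mem_singleton] at h1 h2
    exact hab (h1.1.symm.trans h2.1)

lemma mem_SVT {n : ℕ} {lam : ℕ → ℕ} {T : Finset ((ℕ × ℕ) × ℕ)} :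
    T ∈ SVT n lam ↔
      (∀ i j e, ((i, j), e) ∈ T → i < n ∧ j < lam i ∧ 1 ≤ e ∧ e ≤ n) ∧
      (∀ i j, i < n → j < lam i → ∃ e, ((i, j), e) ∈ T) ∧
      (∀ i j e f, ((i, j), e) ∈ T → ((i, j + 1), f) ∈ T → e ≤ f) ∧
      (∀ i j e f, ((i, j), e) ∈ T → ((i + 1, j), f) ∈ T → e < f) := by
  simp only [SVT, Finset.mem_filter, Finset.mem_powerset, Finset.subset_iff,
    Finset.mem_product, mem_youngCells, Finset.mem_Icc, Prod.forall, Prod.exists]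
  constructor
  · rintro ⟨h1, h2, h3, h4⟩
    refine ⟨fun i j e h => ?_, fun i j hi hj => ?_, fun i j e f he hf => ?_,
      fun i j e f he hf => ?_⟩
    · have := h1 i j e h
      tauto
    · obtain ⟨a, b, e, h, hh⟩ := h2 i j ⟨hi, hj⟩
      exact ⟨e, hh ▸ h⟩
    · exact h3 _ _ _ he _ _ _ hf rfl rfl
    · exact h4 _ _ _ he _ _ _ hf rfl rfl
  · rintro ⟨h1, h2, h3, h4⟩
    refine ⟨fun i j e h => ?_, fun i j hij => ?_, fun i j e he i' j' f hf h h' => ?_,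
      fun i j e he i' j' f hf h h' => ?_⟩
    · have := h1 i j e h
      tauto
    · obtain ⟨e, h⟩ := h2 i j hij.1 hij.2
      exact ⟨i, j, e, h, rfl⟩
    · subst h h'
      exact h3 _ _ _ _ he hf
    · subst h h'
      exact h4 _ _ _ _ he hf

lemma mem_tog {T : Finset ((ℕ × ℕ) × ℕ)} {x y : (ℕ × ℕ) × ℕ} (h : y ≠ x) :
    y ∈ tog T x ↔ y ∈ T := by
  unfold tog
  split_ifs <;> simp [h]

lemma tog_tog (T : Finset ((ℕ × ℕ) × ℕ)) (x : (ℕ × ℕ) × ℕ) : tog (tog T x) x = T := by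
  unfold tog
  by_cases h : x ∈ T <;> simp [h]

lemma tog_ne (T : Finset ((ℕ × ℕ) × ℕ)) (x : (ℕ × ℕ) × ℕ) : tog T x ≠ T := by
  unfold tog
  intro hh
  by_cases h : x ∈ T
  · simp [h] at hh
  · simp [h] at hh

lemma sign_tog {R : Type*} [CommRing R] (T : Finset ((ℕ × ℕ) × ℕ)) (x : (ℕ × ℕ) × ℕ) :
    (-1 : R) ^ T.card + (-1 : R) ^ (tog T x).card = 0 := by
  unfold tog
  by_cases h : x ∈ T
  · rw [if_pos h, ← Finset.card_erase_add_one h, pow_succ]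
    ring
  · rw [if_neg h, Finset.card_insert_of_notMem h, pow_succ]
    ring

lemma badBox_tog (T : Finset ((ℕ × ℕ) × ℕ)) (p : ℕ × ℕ) :
    badBox (tog T (p, p.1 + 1)) = badBox T := by
  funext k
  apply propext
  unfold badBox
  refine exists_congr fun e => and_congr_left fun he => mem_tog ?_
  intro h
  simp only [Prod.mk.injEq] at h
  exact he (by rw [h.2, h.1])

lemma togEntry_spec {T : Finset ((ℕ × ℕ) × ℕ)} (h : ∃ k, badBox T k) :
    ∃ i j, togEntry T = ((i, j), i + 1) ∧ (∃ e, ((i, j), e) ∈ T ∧ e ≠ i + 1) ∧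
      ∀ i' j' e, Nat.pair i' j' < Nat.pair i j → ((i', j'), e) ∈ T → e = i' + 1 := by
  classical
  refine ⟨(Nat.unpair (Nat.find h)).1, (Nat.unpair (Nat.find h)).2, ?_, ?_, ?_⟩
  · simp [togEntry, togOf, h]
  · exact Nat.find_spec h
  · intro i' j' e hlt he
    rw [Nat.pair_unpair] at hlt
    by_contra hne
    exact Nat.find_min h hlt ⟨e, by simpa using he, by simpa using hne⟩

lemma togEntry_congr {T S : Finset ((ℕ × ℕ) × ℕ)} (h : badBox T = badBox S) :
    togEntry T = togEntry S := by
  unfold togEntry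
  rw [h]

lemma togEntry_tog {T : Finset ((ℕ × ℕ) × ℕ)} (h : ∃ k, badBox T k) :
    togEntry (tog T (togEntry T)) = togEntry T := by
  obtain ⟨i, j, h1, -, -⟩ := togEntry_spec h
  apply togEntry_congr
  rw [h1]
  exact badBox_tog T (i, j)

lemma tog_mem {n : ℕ} {lam : ℕ → ℕ} (hdec : ∀ i j : ℕ, i ≤ j → lam j ≤ lam i)
    {T : Finset ((ℕ × ℕ) × ℕ)} (hT : T ∈ SVT n lam) (h : ∃ k, badBox T k) :
    tog T (togEntry T) ∈ SVT n lam := by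
  obtain ⟨i, j, h1, ⟨e, he, hne⟩, hmin⟩ := togEntry_spec h
  rw [h1]
  rw [mem_SVT] at hT ⊢
  obtain ⟨a1, a2, a3, a4⟩ := hT
  have hc := a1 i j e he
  have hle : i + 1 ≤ e := by
    cases i with
    | zero => omega
    | succ i =>
      obtain ⟨f, hf⟩ := a2 i j (by omega) (lt_of_lt_of_le hc.2.1 (hdec _ _ (by omega)))
      have := hmin i j f (Nat.pair_lt_pair_left _ (by omega)) hf
      have := a4 _ _ _ _ hf he
      omega
  have hsub : ∀ a b f, ((a, b), f) ∈ tog T ((i, j), i + 1) →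
      ((a, b), f) ∈ T ∨ (a = i ∧ b = j ∧ f = i + 1) := by
    intro a b f hf
    by_cases hx : ((a, b), f) = ((i, j), i + 1)
    · right
      simpa [and_assoc] using hx
    · left
      rwa [mem_tog hx] at hf
  refine ⟨?_, ?_, ?_, ?_⟩
  · intro a b f hf
    rcases hsub a b f hf with hf | ⟨rfl, rfl, rfl⟩
    · exact a1 _ _ _ hf
    · exact ⟨hc.1, hc.2.1, by omega, by omega⟩
  · intro a b ha hb
    by_cases hx : (a, b) = (i, j)
    · refine ⟨e, ?_⟩
      rw [hx, mem_tog]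
      · exact he
      · simpa using hne
    · obtain ⟨f, hf⟩ := a2 a b ha hb
      refine ⟨f, ?_⟩
      rw [mem_tog]
      · exact hf
      · intro hh
        exact hx (congrArg Prod.fst hh)
  · intro a b f g hf hg
    rcases hsub _ _ _ hf with hf' | ⟨rfl, rfl, rfl⟩
    · rcases hsub _ _ _ hg with hg | ⟨rfl, rfl, rfl⟩
      · exact a3 _ _ _ _ hf' hg
      · exact (hmin _ _ _ (Nat.pair_lt_pair_right _ (by omega)) hf').le
    · rcases hsub _ _ _ hg with hg | ⟨_, h2, _⟩
      · exact hle.trans (a3 _ _ _ _ he hg)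
      · omega
  · intro a b f g hf hg
    rcases hsub _ _ _ hf with hf' | ⟨rfl, rfl, rfl⟩
    · rcases hsub _ _ _ hg with hg | ⟨rfl, rfl, rfl⟩
      · exact a4 _ _ _ _ hf' hg
      · have := hmin _ _ _ (Nat.pair_lt_pair_left _ (by omega)) hf'
        omega
    · rcases hsub _ _ _ hg with hg | ⟨h2, _, _⟩
      · exact lt_of_le_of_lt hle (a4 _ _ _ _ he hg)
      · omega

/-- The minimal tableau. -/
def minTab (n : ℕ) (lam : ℕ → ℕ) : Finset ((ℕ × ℕ) × ℕ) :=
  (youngCells n lam).image fun p => (p, p.1 + 1)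

lemma mem_minTab {n : ℕ} {lam : ℕ → ℕ} {i j e : ℕ} :
    ((i, j), e) ∈ minTab n lam ↔ i < n ∧ j < lam i ∧ e = i + 1 := by
  simp only [minTab, Finset.mem_image, mem_youngCells, Prod.mk.injEq, Prod.exists]
  constructor
  · rintro ⟨a, b, ⟨h1, h2⟩, ⟨rfl, rfl⟩, rfl⟩
    exact ⟨h1, h2, rfl⟩
  · rintro ⟨h1, h2, rfl⟩
    exact ⟨i, j, ⟨h1, h2⟩, ⟨rfl, rfl⟩, rfl⟩

lemma card_minTab (n : ℕ) (lam : ℕ → ℕ) :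
    (minTab n lam).card = ∑ i ∈ Finset.range n, lam i := by
  rw [minTab, Finset.card_image_of_injective, card_youngCells]
  intro p q h
  exact congrArg Prod.fst h

lemma minTab_mem (n : ℕ) (lam : ℕ → ℕ) : minTab n lam ∈ SVT n lam := by
  rw [mem_SVT]
  simp only [mem_minTab]
  refine ⟨?_, ?_, ?_, ?_⟩
  · rintro i j e ⟨h1, h2, rfl⟩
    exact ⟨h1, h2, by omega, by omega⟩
  · intro i j h1 h2
    exact ⟨i + 1, h1, h2, rfl⟩
  · intros
    omega
  · intros
    omega

lemma exists_bad_iff {n : ℕ} {lam : ℕ → ℕ} {T : Finset ((ℕ × ℕ) × ℕ)} (hT : T ∈ SVT n lam) :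
    (∃ k, badBox T k) ↔ T ≠ minTab n lam := by
  constructor
  · rintro ⟨k, e, he, hne⟩ rfl
    exact hne (mem_minTab.1 he).2.2
  · intro hne
    by_contra hb
    apply hne
    have key : ∀ i j e, ((i, j), e) ∈ T → e = i + 1 := by
      intro i j e he
      by_contra h
      exact hb ⟨Nat.pair i j, e, by simpa using he, by simpa using h⟩
    rw [mem_SVT] at hT
    ext ⟨⟨i, j⟩, e⟩
    rw [mem_minTab]
    constructor
    · intro h
      have := hT.1 i j e h
      exact ⟨this.1, this.2.1, key _ _ _ h⟩
    · rintro ⟨h1, h2, rfl⟩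
      obtain ⟨f, hf⟩ := hT.2.1 i j h1 h2
      rwa [key _ _ _ hf] at hf

lemma card_le_of_mem_SVT {n : ℕ} {lam : ℕ → ℕ} {T : Finset ((ℕ × ℕ) × ℕ)}
    (hT : T ∈ SVT n lam) : ∑ i ∈ Finset.range n, lam i ≤ T.card := by
  rw [← card_youngCells]
  refine (Finset.card_le_card ?_).trans (Finset.card_image_le (s := T) (f := Prod.fst))
  rintro ⟨i, j⟩ h
  rw [mem_youngCells] at h
  obtain ⟨e, he⟩ := (mem_SVT.1 hT).2.1 i j h.1 h.2
  exact Finset.mem_image.2 ⟨_, he, rfl⟩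

lemma signed_sum {n : ℕ} {lam : ℕ → ℕ} (hdec : ∀ i j : ℕ, i ≤ j → lam j ≤ lam i)
    {R : Type*} [CommRing R] :
    ∑ T ∈ SVT n lam, (-1 : R) ^ T.card = (-1) ^ (∑ i ∈ Finset.range n, lam i) := by
  rw [← Finset.add_sum_erase _ _ (minTab_mem n lam), card_minTab]
  rw [add_eq_left]
  have hbad : ∀ T ∈ (SVT n lam).erase (minTab n lam), ∃ k, badBox T k := by
    intro T hT
    rw [Finset.mem_erase] at hT
    exact (exists_bad_iff hT.2).2 hT.1
  refine Finset.sum_involution (fun T _ => tog T (togEntry T)) ?_ ?_ ?_ ?_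
  · intro T _
    exact sign_tog T _
  · intro T _ _
    exact tog_ne T _
  · intro T hT
    have hb := hbad T hT
    have hm := tog_mem hdec (Finset.mem_erase.1 hT).2 hb
    refine Finset.mem_erase.2 ⟨(exists_bad_iff hm).1 ?_, hm⟩
    obtain ⟨i, j, h1, -, -⟩ := togEntry_spec hb
    have h2 := badBox_tog T (i, j)
    rw [h1, h2]
    exact hb
  · intro T hT
    rw [togEntry_tog (hbad T hT), tog_tog]

/-- For `n ≥ 1`, a partition `λ` with at most `n` nonzero parts padded
with zeros to length `n`, and any unit `β` of a commutative ring: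
`Σ_{T ∈ SVT(λ,n)} (−β⁻¹)^(|T|−|λ|) · β^(|T|) = β^(|λ|)`,
i.e. `G_λ(β, …, β | −β⁻¹) = β^(|λ|)` for the tableau-sum Grothendieck polynomial
(since `x_1 = ⋯ = x_n = β` gives `x^(ω(T)) = β^(|T|)`). -/
theorem grothendieck_at_beta (n : ℕ) (hn : 1 ≤ n) (lam : ℕ → ℕ)
    (hdec : ∀ i j : ℕ, i ≤ j → lam j ≤ lam i) (hpad : ∀ i : ℕ, n ≤ i → lam i = 0)
    {R : Type*} [CommRing R] (β : Rˣ) :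
    ∑ T ∈ SVT n lam,
        (-((β⁻¹ : Rˣ) : R)) ^ (T.card - ∑ i ∈ Finset.range n, lam i) * (β : R) ^ T.card
      = (β : R) ^ (∑ i ∈ Finset.range n, lam i) := by
  have key : ∀ T ∈ SVT n lam,
      (-((β⁻¹ : Rˣ) : R)) ^ (T.card - ∑ i ∈ Finset.range n, lam i) * (β : R) ^ T.card
        = (β : R) ^ (∑ i ∈ Finset.range n, lam i) * (-1) ^ (∑ i ∈ Finset.range n, lam i)
          * (-1) ^ T.card := by
    intro T hT
    obtain ⟨d, hd⟩ := Nat.exists_eq_add_of_le (card_le_of_mem_SVT hT)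
    rw [hd]
    generalize ∑ i ∈ Finset.range n, lam i = L
    have hβ : ((β⁻¹ : Rˣ) : R) ^ d * (β : R) ^ d = 1 := by
      rw [← mul_pow, Units.inv_mul, one_pow]
    have hs : (-1 : R) ^ L * (-1) ^ L = 1 := by
      rw [← mul_pow]
      simp
    rw [Nat.add_sub_cancel_left, neg_pow, pow_add, pow_add]
    linear_combination (-1) ^ d * (β : R) ^ L * hβ - (-1) ^ d * (β : R) ^ L * hs
  rw [Finset.sum_congr rfl key, ← Finset.mul_sum, signed_sum hdec, mul_assoc, ← mul_pow]
  simp
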